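/- Let Γ be a countable discrete group, ρ a finite IRE on Γ, X a nonempty standard Borel space with a Borel action of Γ, and x₀ ∈ X. Then there exists a classwise coherent X-marking of ρ. (One such marking is obtained by marking, in each class, an independently uniformly chosen representative by x₀ and extending by local equivariance: the mark of h in the class of the chosen point v is h⁻¹v·x₀.) -/

import Mathlib

open MeasureTheory Filter Topology

/-- A function `r : Γ × Γ → Bool` codes an equivalence relation on `Γ`. -/
def IsEqRel {Γ : Type*} (r : Γ × Γ → Bool) : Prop :=
  (∀ x, r (x, x) = true) ∧ (∀ x y, r (x, y) = true → r (y, x) = true) ∧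
    (∀ x y z, r (x, y) = true → r (y, z) = true → r (x, z) = true)

/-- The space `E` of equivalence relations on `Γ`, as a subspace of `{0,1}^{Γ×Γ}`. -/
abbrev EqRelSpace (Γ : Type*) : Type _ := ↥{r : Γ × Γ → Bool | IsEqRel r}

variable {Γ : Type*} [Group Γ]

/-- The left shift action of `Γ` on the space of equivalence relations:
`(γ·r)(x,y) = r(γ⁻¹x, γ⁻¹y)`. -/
def shiftE (γ : Γ) (r : EqRelSpace Γ) : EqRelSpace Γ :=
  ⟨fun p => r.1 (γ⁻¹ * p.1, γ⁻¹ * p.2),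
    ⟨fun _ => r.2.1 _, fun _ _ h => r.2.2.1 _ _ h, fun _ _ _ h h' => r.2.2.2 _ _ _ h h'⟩⟩

/-- The `r`-class of `g ∈ Γ`. -/
def classOf (r : EqRelSpace Γ) (g : Γ) : Set Γ := {h | r.1 (g, h) = true}

/-- An invariant random equivalence relation: a Borel probability measure on `E`
invariant under the left shift action. -/
def IsIRE (ρ : ProbabilityMeasure (EqRelSpace Γ)) : Prop :=
  ∀ γ : Γ, ρ.toMeasure.map (shiftE γ) = ρ.toMeasure

/-- A finite IRE: almost every equivalence relation has all classes finite. -/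
def IsFIRE {Γ : Type*} [Group Γ] (ρ : ProbabilityMeasure (EqRelSpace Γ)) : Prop :=
  IsIRE ρ ∧ ∀ᵐ r ∂ρ.toMeasure, ∀ g : Γ, (classOf r g).Finite

/-- Topological amenability of an action `a : Γ → X → X` on a topological space:
there are continuous maps `η_n : X → Prob(Γ)` (coded coordinatewise) with
`sup_x ‖γ·η_n^x − η_n^{γ·x}‖₁ → 0` for every `γ`; here `(γ·η)(g) = η(γ⁻¹g)`. -/
def TopAmenableAction (Γ : Type*) [Group Γ] {X : Type*} [TopologicalSpace X]
    (a : Γ → X → X) : Prop :=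
  ∃ η : ℕ → X → Γ → ℝ,
    (∀ n x g, 0 ≤ η n x g) ∧
    (∀ n x, ∑' g, η n x g = 1) ∧
    (∀ n g, Continuous fun x => η n x g) ∧
    ∀ γ : Γ, ∀ ε > (0 : ℝ), ∃ N, ∀ n ≥ N, ∀ x : X,
      ∑' g : Γ, |η n x (γ⁻¹ * g) - η n (a γ x) g| < ε

/-- A classwise coherent `Ξ`-marking of an IRE `ρ`, for an action `a : Γ → Ξ → Ξ`:
a `Γ`-invariant Borel probability measure on `E × Ξ^Γ` (for the diagonal action, where
`Γ` acts on `Ξ^Γ` by `(γ·f)(x) = f(γ⁻¹x)`) projecting to `ρ`, such that almost surely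
`g·(f(g)) = h·(f(h))` for every pair `(g,h)` in the relation. -/
def IsCCMarking {Γ : Type*} [Group Γ] {Ξ : Type*} [MeasurableSpace Ξ] (a : Γ → Ξ → Ξ)
    (ρ : ProbabilityMeasure (EqRelSpace Γ))
    (ρ' : ProbabilityMeasure (EqRelSpace Γ × (Γ → Ξ))) : Prop :=
  (∀ γ : Γ, ρ'.toMeasure.map
      (fun p => (shiftE γ p.1, fun x => p.2 (γ⁻¹ * x))) = ρ'.toMeasure) ∧
  ρ'.toMeasure.map Prod.fst = ρ.toMeasure ∧
  ∀ᵐ p ∂ρ'.toMeasure, ∀ g h : Γ, p.1.1 (g, h) = true → a g (p.2 g) = a h (p.2 h)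

/-- `IsLabelMin p h v` says that `v` carries the strictly smallest label of the class of `h`,
for the relation `p.1` and the labelling `p.2`. -/
def IsLabelMin {L : Type*} [LT L] (p : EqRelSpace Γ × (Γ → L)) (h v : Γ) : Prop :=
  p.1.1 (h, v) = true ∧ ∀ w, p.1.1 (h, w) = true → w ≠ v → p.2 v < p.2 w

section LabelMin

variable {L : Type*}

theorem IsLabelMin.unique {Γ : Type*} [Preorder L] {p : EqRelSpace Γ × (Γ → L)} {h v w : Γ}
    (hv : IsLabelMin p h v) (hw : IsLabelMin p h w) : v = w := by
  by_contra hne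
  exact lt_asymm (hv.2 w hw.1 (Ne.symm hne)) (hw.2 v hv.1 hne)

theorem isLabelMin_congr {Γ : Type*} [LT L] {p : EqRelSpace Γ × (Γ → L)} {g h : Γ}
    (hgh : p.1.1 (g, h) = true) (v : Γ) : IsLabelMin p g v ↔ IsLabelMin p h v := by
  have key : ∀ w, p.1.1 (g, w) = true ↔ p.1.1 (h, w) = true := fun w =>
    ⟨p.1.2.2.2 _ _ _ (p.1.2.2.1 _ _ hgh), p.1.2.2.2 _ _ _ hgh⟩
  simp only [IsLabelMin, key]

/-- The diagonal shift on pairs of a relation and a labelling. -/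
def diagShift (γ : Γ) (p : EqRelSpace Γ × (Γ → L)) : EqRelSpace Γ × (Γ → L) :=
  (shiftE γ p.1, fun x => p.2 (γ⁻¹ * x))

theorem isLabelMin_diagShift [LT L] (γ : Γ) (p : EqRelSpace Γ × (Γ → L)) (h v : Γ) :
    IsLabelMin (diagShift γ p) h v ↔ IsLabelMin p (γ⁻¹ * h) (γ⁻¹ * v) := by
  refine and_congr Iff.rfl ⟨fun H w hw hne => ?_, fun H w hw hne => H _ hw (by simpa using hne)⟩
  have := H (γ * w) (by simpa [diagShift, shiftE] using hw)
    (by rintro rfl; simp at hne)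
  simpa [diagShift] using this

open Classical in
/-- The point with the strictly smallest label in the class of `h`, if there is one. -/
noncomputable def labelMin [LT L] (h : Γ) (p : EqRelSpace Γ × (Γ → L)) : Option Γ :=
  if H : ∃ v, IsLabelMin p h v then some H.choose else none

theorem labelMin_eq_some_iff {Γ : Type*} [Preorder L] {h v : Γ} {p : EqRelSpace Γ × (Γ → L)} :
    labelMin h p = some v ↔ IsLabelMin p h v := by
  unfold labelMin
  split_ifs with H
  · rw [Option.some_inj]
    exact ⟨fun e => e ▸ H.choose_spec, fun hv => H.choose_spec.unique hv⟩
  · simpa using fun hv => H ⟨v, hv⟩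

theorem labelMin_diagShift [Preorder L] (γ h : Γ) (p : EqRelSpace Γ × (Γ → L)) :
    labelMin h (diagShift γ p) = (labelMin (γ⁻¹ * h) p).map (γ * ·) := by
  ext v
  simp only [labelMin_eq_some_iff, isLabelMin_diagShift, Option.map_eq_some_iff]
  exact ⟨fun H => ⟨_, H, by simp⟩, by rintro ⟨w, hw, rfl⟩; simpa using hw⟩

theorem labelMin_congr {Γ : Type*} [Preorder L] {p : EqRelSpace Γ × (Γ → L)} {g h : Γ}
    (hgh : p.1.1 (g, h) = true) : labelMin g p = labelMin h p := by
  ext v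
  simp only [labelMin_eq_some_iff, isLabelMin_congr hgh]

theorem exists_labelMin_eq_some {Γ : Type*} [LinearOrder L] {p : EqRelSpace Γ × (Γ → L)} {h : Γ}
    (hfin : (classOf p.1 h).Finite) (hinj : Function.Injective p.2) :
    ∃ v, labelMin h p = some v := by
  obtain ⟨v, hv, hmin⟩ := Set.exists_min_image _ p.2 hfin ⟨h, p.1.2.1 h⟩
  exact ⟨v, labelMin_eq_some_iff.2 ⟨hv, fun w hw hne =>
    lt_of_le_of_ne (hmin w hw) fun e => hne (hinj e).symm⟩⟩

/-- Mark the label-minimal point of each class by `x₀` and extend by local equivariance; classes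
without a label-minimal point are marked by the constant `x₀`. -/
noncomputable def minMarking [LT L] {X : Type*} (a : Γ → X → X) (x₀ : X)
    (p : EqRelSpace Γ × (Γ → L)) (h : Γ) : X :=
  (labelMin h p).elim x₀ fun v => a (h⁻¹ * v) x₀

theorem minMarking_diagShift [Preorder L] {X : Type*} (a : Γ → X → X) (x₀ : X) (γ : Γ)
    (p : EqRelSpace Γ × (Γ → L)) :
    minMarking a x₀ (diagShift γ p) = fun h => minMarking a x₀ p (γ⁻¹ * h) := by
  funext h
  rw [minMarking, minMarking, labelMin_diagShift]
  cases labelMin (γ⁻¹ * h) p <;> simp [mul_assoc]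

section Measurability

theorem measurable_shiftE (γ : Γ) : Measurable (shiftE γ) :=
  Measurable.subtype_mk <| measurable_pi_lambda _ fun p =>
    (measurable_pi_apply (γ⁻¹ * p.1, γ⁻¹ * p.2)).comp measurable_subtype_coe

theorem measurable_diagShift [MeasurableSpace L] (γ : Γ) :
    Measurable (diagShift (L := L) γ) :=
  ((measurable_shiftE γ).comp measurable_fst).prodMk (by fun_prop)

theorem measurableSet_related {Γ : Type*} {Y : Type*} [MeasurableSpace Y] (g h : Γ) :
    MeasurableSet {p : EqRelSpace Γ × Y | p.1.1 (g, h) = true} :=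
  measurableSet_eq_fun ((measurable_pi_apply (g, h)).comp
    (measurable_subtype_coe.comp measurable_fst)) measurable_const

variable [LinearOrder L] [TopologicalSpace L] [OrderClosedTopology L]
  [SecondCountableTopology L] [MeasurableSpace L] [OpensMeasurableSpace L]

theorem measurableSet_isLabelMin {Γ : Type*} [Countable Γ] (h v : Γ) :
    MeasurableSet {p : EqRelSpace Γ × (Γ → L) | IsLabelMin p h v} := by
  refine (measurableSet_related h v).inter (MeasurableSet.congr (MeasurableSet.iInter fun w =>
    (measurableSet_related h w).himp ((MeasurableSet.const (w ≠ v)).himp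
      (measurableSet_lt (f := fun p : EqRelSpace Γ × (Γ → L) => p.2 v)
        (g := fun p => p.2 w) (by fun_prop) (by fun_prop)))) ?_)
  ext p
  simp only [Set.mem_iInter, Set.mem_himp_iff]
  rfl

theorem measurable_minMarking [Countable Γ] {X : Type*} [MeasurableSpace X] (a : Γ → X → X) (x₀ : X) :
    Measurable (minMarking (L := L) a x₀) := by
  let _ : MeasurableSpace (Option Γ) := ⊤
  refine measurable_pi_lambda _ fun h => ?_
  have hmin : Measurable (labelMin (L := L) h) := by
    have hsome : ∀ v, MeasurableSet (labelMin (L := L) h ⁻¹' {some v}) := fun v => by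
      convert measurableSet_isLabelMin (L := L) h v using 1
      ext p
      simp [labelMin_eq_some_iff]
    refine measurable_to_countable' fun o => ?_
    cases o with
    | some v => exact hsome v
    | none =>
      convert (MeasurableSet.iUnion hsome).compl using 1
      ext p
      simp [Option.eq_none_iff_forall_ne_some]
  exact (measurable_from_top (f := fun o : Option Γ => o.elim x₀ fun v => a (h⁻¹ * v) x₀)).comp hmin

end Measurability

end LabelMin

/-- Countably many independent labels with a common diffuse law are almost surely distinct. -/
theorem ae_injective_infinitePi {ι L : Type*} [Countable ι] [MeasurableSpace L] [MeasurableEq L]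
    [MeasurableSingletonClass L] (ν : Measure L) [IsProbabilityMeasure ν] [NullSingletonClass ν] :
    ∀ᵐ u ∂Measure.infinitePi (fun _ : ι => ν), Function.Injective u := by
  have hne : ∀ᵐ q ∂ν.prod ν, q.1 ≠ q.2 := by
    refine (Measure.ae_prod_iff_ae_ae (p := fun q : L × L => q.1 ≠ q.2)
      measurableSet_diagonal.compl).2 ?_
    exact .of_forall fun x => (ae_iff.2 (by simp))
  have key : ∀ i j : ι, i ≠ j → ∀ᵐ u ∂Measure.infinitePi (fun _ : ι => ν), u i ≠ u j := by
    intro i j hij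
    rw [← Measure.infinitePi_map_eval_prod (P := fun _ : ι => ν) hij] at hne
    exact ae_of_ae_map (f := fun u : ι → L => (u i, u j)) (by fun_prop) hne
  have hall : ∀ᵐ u ∂Measure.infinitePi (fun _ : ι => ν), ∀ i j : ι, i ≠ j → u i ≠ u j := by
    simpa only [ae_all_iff] using key
  filter_upwards [hall] with u hu i j e
  by_contra hij
  exact hu i j hij e

theorem measurePreserving_diagShift {L : Type*} [MeasurableSpace L]
    {ρ : ProbabilityMeasure (EqRelSpace Γ)} (hρ : IsIRE ρ) (ν : Measure L)
    [IsProbabilityMeasure ν] (γ : Γ) :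
    MeasurePreserving (diagShift γ) (ρ.toMeasure.prod (Measure.infinitePi fun _ : Γ => ν))
      (ρ.toMeasure.prod (Measure.infinitePi fun _ : Γ => ν)) :=
  MeasurePreserving.prod ⟨measurable_shiftE γ, hρ γ⟩
    ⟨by fun_prop, Measure.map_infinitePi_infinitePi_of_inj (P := fun _ : Γ => ν)
      (mul_right_injective γ⁻¹)⟩

/-- Example/Proposition: every finite IRE admits a classwise coherent `X`-marking, for any
Borel action of `Γ` on a nonempty standard Borel space `X` and any basepoint `x₀ ∈ X`
(e.g. mark a uniformly random point of each class by `x₀` and extend by local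
equivariance). -/
theorem FIRE_has_CCMarking
    {Γ : Type*} [Group Γ] [Countable Γ]
    {X : Type*} [MeasurableSpace X] [StandardBorelSpace X] [Nonempty X]
    (a : Γ → X → X)
    (hone : ∀ x, a 1 x = x) (hmul : ∀ γ δ x, a (γ * δ) x = a γ (a δ x))
    (hameas : ∀ γ, Measurable (a γ))
    (ρ : ProbabilityMeasure (EqRelSpace Γ)) (hρ : IsFIRE ρ) (x₀ : X) :
    ∃ ρ' : ProbabilityMeasure (EqRelSpace Γ × (Γ → X)), IsCCMarking a ρ ρ' := by
  let μ := ρ.toMeasure.prod (Measure.infinitePi fun _ : Γ => (volume : Measure unitInterval))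
  let F : EqRelSpace Γ × (Γ → unitInterval) → EqRelSpace Γ × (Γ → X) :=
    fun p => (p.1, minMarking a x₀ p)
  have hF : Measurable F := measurable_fst.prodMk (measurable_minMarking a x₀)
  refine ⟨⟨μ.map F, Measure.isProbabilityMeasure_map hF.aemeasurable⟩, fun γ => ?_, ?_, ?_⟩
  · have hcomm : diagShift γ ∘ F = F ∘ diagShift γ :=
      funext fun p => Prod.ext rfl (minMarking_diagShift a x₀ γ p).symm
    change (μ.map F).map (diagShift γ) = μ.map F
    rw [Measure.map_map (measurable_diagShift γ) hF, hcomm,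
      ← Measure.map_map hF (measurable_diagShift γ),
      (measurePreserving_diagShift hρ.1 volume γ).map_eq]
  · change (μ.map F).map Prod.fst = ρ.toMeasure
    rw [Measure.map_map measurable_fst hF]
    exact measurePreserving_fst.map_eq
  · have hmeas : MeasurableSet {p : EqRelSpace Γ × (Γ → X) |
        ∀ g h : Γ, p.1.1 (g, h) = true → a g (p.2 g) = a h (p.2 h)} := by
      simp only [Set.ofPred_forall]
      refine MeasurableSet.iInter fun g => MeasurableSet.iInter fun h =>
        (measurableSet_related g h).imp (measurableSet_eq_fun ?_ ?_)
      · exact (hameas g).comp ((measurable_pi_apply g).comp measurable_snd)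
      · exact (hameas h).comp ((measurable_pi_apply h).comp measurable_snd)
    refine (ae_map_iff hF.aemeasurable hmeas).2 ?_
    have hfin : ∀ᵐ p ∂μ, ∀ g, (classOf p.1 g).Finite :=
      Measure.quasiMeasurePreserving_fst.ae hρ.2
    have hinj : ∀ᵐ p ∂μ, Function.Injective p.2 :=
      Measure.quasiMeasurePreserving_snd.ae (ae_injective_infinitePi volume)
    filter_upwards [hfin, hinj] with p hp hu g h hgh
    obtain ⟨v, hv⟩ := exists_labelMin_eq_some (hp g) hu
    have hv' : labelMin h p = some v := labelMin_congr (p := p) hgh ▸ hv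
    simp [F, minMarking, hv, hv', ← hmul]
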